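/- Equivalence of the Grünwald–Letnikov and Riemann–Liouville definitions for fractional integration of a continuous function: let f : ℝ → ℝ be continuous on [0, x] for a fixed x > 0 and let α > 0. Then, as h → 0⁺, the Grünwald–Letnikov sums h^α · Σ_{j=0}^{⌊x/h⌋} (−1)^j · C(−α, j) · f(x − j·h) converge to (1/Γ(α)) ∫₀ˣ (x−t)^{α−1} f(t) dt, where C(−α, j) = (−α)(−α−1)⋯(−α−j+1)/j! is the generalized binomial coefficient (so (−1)^j C(−α, j) = Γ(α+j)/(Γ(α)·j!)). -/

import Mathlib

open intervalIntegral Real Filter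

/-- The coefficients `(-1)^j C(-α, j)`, normalised by `(j + 1)^(1 - α)`, tend to `1 / Γ(α)`. -/
theorem tendsto_neg_one_pow_mul_choose_neg_mul_rpow {α : ℝ} (hα : 0 < α) :
    Tendsto (fun n : ℕ => (-1 : ℝ) ^ n *
      ((∏ k ∈ Finset.range n, (-α - (k : ℝ))) / (Nat.factorial n)) * ((n : ℝ) + 1) ^ (1 - α))
      atTop (nhds (Real.Gamma α)⁻¹) := by
  have hΓ : (Real.Gamma α) ≠ 0 := (Real.Gamma_pos_of_pos hα).ne'
  have h₁ := (Real.GammaSeq_tendsto_Gamma α).inv₀ hΓ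
  have h₂ : Tendsto (fun n : ℕ => (n : ℝ) / (n + α)) atTop (nhds 1) :=
    tendsto_natCast_div_add_atTop α
  have h₃ : Tendsto (fun n : ℕ => (((n : ℝ) / (n + 1))⁻¹) ^ (1 - α)) atTop (nhds 1) := by
    have := ((tendsto_natCast_div_add_atTop (1 : ℝ)).inv₀ one_ne_zero).rpow_const
      (p := 1 - α) (Or.inl (by norm_num))
    simpa using this
  have h₄ := (h₁.mul h₂).mul h₃
  simp only [mul_one] at h₄
  refine h₄.congr' ?_
  filter_upwards [eventually_gt_atTop 0] with n hn
  have hn' : (0 : ℝ) < n := by exact_mod_cast hn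
  have hprod : (-1 : ℝ) ^ n * ∏ k ∈ Finset.range n, (-α - (k : ℝ)) =
      ∏ k ∈ Finset.range n, (α + (k : ℝ)) := by
    rw [← Finset.card_range n, ← Finset.prod_const, Finset.card_range, ← Finset.prod_mul_distrib]
    exact Finset.prod_congr rfl fun k _ => by ring
  have hpow : (n : ℝ) ^ α * (n : ℝ) ^ (1 - α) = n := by
    rw [← Real.rpow_add hn', add_sub_cancel, Real.rpow_one]
  have hpos : (0 : ℝ) < (n : ℝ) ^ α := Real.rpow_pos_of_pos hn' _
  have hpos' : (0 : ℝ) < (n : ℝ) ^ (1 - α) := Real.rpow_pos_of_pos hn' _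
  rw [← mul_div_assoc ((-1 : ℝ) ^ n), hprod, Real.GammaSeq, Finset.prod_range_succ, inv_div, inv_div,
    Real.div_rpow (by positivity) hn'.le]
  have : (n : ℝ) + α ≠ 0 := by positivity
  have : (n.factorial : ℝ) ≠ 0 := by positivity
  rw [add_comm α (n : ℝ)]
  field_simp
  exact hpow.symm

/-- The integral of a step function that is constant on the cells `[j h, (j + 1) h)`. -/
theorem integral_comp_natFloor_div {h : ℝ} (hh : 0 < h) (G : ℕ → ℝ) (n : ℕ) :
    IntervalIntegrable (fun u => G ⌊u / h⌋₊) MeasureTheory.volume 0 (n * h) ∧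
      ∫ u in (0 : ℝ)..(n * h), G ⌊u / h⌋₊ = ∑ j ∈ Finset.range n, h * G j := by
  have hcell : ∀ j : ℕ, Set.EqOn (fun _ => G j) (fun u => G ⌊u / h⌋₊)
      (Set.Ioo ((j : ℝ) * h) ((j + 1 : ℕ) * h)) := by
    intro j u hu
    obtain ⟨h₁, h₂⟩ := hu
    have hj : ⌊u / h⌋₊ = j := by
      rw [Nat.floor_eq_iff (by have : 0 ≤ (j : ℝ) * h := by positivity
                               exact div_nonneg (by linarith) hh.le)]
      push_cast at h₂
      exact ⟨(le_div_iff₀ hh).2 h₁.le, (div_lt_iff₀ hh).2 h₂⟩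
    simp [hj]
  have hle : ∀ j : ℕ, (j : ℝ) * h ≤ (j + 1 : ℕ) * h := fun j => by
    push_cast; nlinarith
  have hint : ∀ j : ℕ, IntervalIntegrable (fun u => G ⌊u / h⌋₊) MeasureTheory.volume
      (j * h) ((j + 1 : ℕ) * h) := fun j => by
    refine (intervalIntegrable_const (c := G j)).congr_uIoo ?_
    rw [Set.uIoo_of_le (hle j)]
    exact hcell j
  refine ⟨?_, ?_⟩
  · have := IntervalIntegrable.trans_iterate (a := fun j : ℕ => (j : ℝ) * h) (n := n)
      fun j _ => hint j
    simpa using this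
  · have := sum_integral_adjacent_intervals (a := fun j : ℕ => (j : ℝ) * h) (n := n)
      fun j _ => hint j
    simp only [Nat.cast_zero, zero_mul] at this
    rw [← this]
    refine Finset.sum_congr rfl fun j _ => ?_
    have : ∫ u in (j * h : ℝ)..((j + 1 : ℕ) * h), G ⌊u / h⌋₊ =
        ∫ u in (j * h : ℝ)..((j + 1 : ℕ) * h), G j := by
      refine integral_congr_Ioo_of_le (hle j) ?_
      exact (hcell j).symm
    rw [this, integral_const, smul_eq_mul]
    push_cast
    ring

theorem natFloor_div_mul_mem_Ioc {u h : ℝ} (hu : 0 ≤ u) (hh : 0 < h) :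
    (⌊u / h⌋₊ : ℝ) * h ∈ Set.Ioc (u - h) u := by
  have h₁ := Nat.floor_le (div_nonneg hu hh.le)
  have h₂ := Nat.lt_floor_add_one (u / h)
  rw [le_div_iff₀ hh] at h₁
  rw [div_lt_iff₀ hh] at h₂
  exact ⟨by linarith, h₁⟩

theorem tendsto_natFloor_div_mul {u : ℝ} (hu : 0 ≤ u) :
    Tendsto (fun h : ℝ => (⌊u / h⌋₊ : ℝ) * h) (nhdsWithin 0 (Set.Ioi 0)) (nhds u) := by
  have hid : Tendsto (fun h : ℝ => h) (nhdsWithin 0 (Set.Ioi 0)) (nhds 0) :=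
    tendsto_id.mono_left nhdsWithin_le_nhds
  refine tendsto_of_tendsto_of_tendsto_of_le_of_le' (g := fun h => u - h) (h := fun _ => u)
    (by simpa using hid.const_sub u) tendsto_const_nhds ?_ ?_
  · filter_upwards [self_mem_nhdsWithin] with h hh
    exact (natFloor_div_mul_mem_Ioc hu hh).1.le
  · filter_upwards [self_mem_nhdsWithin] with h hh
    exact (natFloor_div_mul_mem_Ioc hu hh).2

/-- Equivalence of the Grünwald–Letnikov and Riemann–Liouville definitions for
fractional integration of a continuous function: as `h → 0⁺`, the
Grünwald–Letnikov sums `h^α · Σ_{j=0}^{⌊x/h⌋} (−1)^j C(−α,j) f(x − j h)`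
converge to the Riemann–Liouville fractional integral
`(1/Γ(α)) ∫₀ˣ (x−t)^{α−1} f(t) dt`, where
`C(−α, j) = (−α)(−α−1)⋯(−α−j+1)/j!`. -/
theorem gruenwald_letnikov_eq_riemann_liouville
    (f : ℝ → ℝ) (x : ℝ) (hx : 0 < x)
    (hf : ContinuousOn f (Set.Icc 0 x)) (α : ℝ) (hα : 0 < α) :
    Filter.Tendsto
      (fun h : ℝ =>
        h ^ α *
          ∑ j ∈ Finset.range (⌊x / h⌋₊ + 1),
            (-1 : ℝ) ^ j *
              ((∏ k ∈ Finset.range j, (-α - (k : ℝ))) / (Nat.factorial j)) *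
              f (x - (j : ℝ) * h))
      (nhdsWithin 0 (Set.Ioi 0))
      (nhds ((1 / Real.Gamma α) * ∫ t in (0:ℝ)..x, (x - t) ^ (α - 1) * f t)) := by
  set c : ℕ → ℝ := fun j => (-1 : ℝ) ^ j *
    ((∏ k ∈ Finset.range j, (-α - (k : ℝ))) / (Nat.factorial j)) with hc
  have ha : Tendsto (fun n : ℕ => c n * ((n : ℝ) + 1) ^ (1 - α)) atTop
      (nhds (Real.Gamma α)⁻¹) := tendsto_neg_one_pow_mul_choose_neg_mul_rpow hα
  obtain ⟨C, hC⟩ := (Metric.isBounded_range_of_tendsto _ ha).exists_norm_le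
  obtain ⟨M, hM⟩ := isCompact_Icc.exists_bound_of_continuousOn hf
  have hC' : ∀ n : ℕ, |c n * ((n : ℝ) + 1) ^ (1 - α)| ≤ C := fun n => hC _ ⟨n, rfl⟩
  have hC0 : 0 ≤ C := (abs_nonneg _).trans (hC' 0)
  have hM0 : 0 ≤ M := (norm_nonneg _).trans (hM 0 ⟨le_rfl, hx.le⟩)
  have hcell : ∀ (h : ℝ) (n : ℕ), 0 < h → h ^ (α - 1) * c n =
      c n * ((n : ℝ) + 1) ^ (1 - α) * ((n : ℝ) * h + h) ^ (α - 1) := by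
    intro h n hh
    have hn : (0 : ℝ) < (n : ℝ) + 1 := by positivity
    have : ((n : ℝ) + 1) ^ (1 - α) * ((n : ℝ) + 1) ^ (α - 1) = 1 := by
      rw [← Real.rpow_add hn]
      simp
    rw [show (n : ℝ) * h + h = (n + 1) * h by ring, Real.mul_rpow hn.le hh.le]
    linear_combination -(c n * h ^ (α - 1)) * this
  set G : ℝ → ℕ → ℝ := fun h j =>
    if j ≤ ⌊x / h⌋₊ then h ^ (α - 1) * c j * f (x - j * h) else 0 with hG
  have hmem : ∀ (h : ℝ) (j : ℕ), 0 < h → j ≤ ⌊x / h⌋₊ → x - j * h ∈ Set.Icc 0 x := by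
    intro h j hh hj
    have h₁ := (natFloor_div_mul_mem_Ioc hx.le hh).2
    have h₂ : (j : ℝ) ≤ ⌊x / h⌋₊ := by exact_mod_cast hj
    have h₃ := mul_le_mul_of_nonneg_right h₂ hh.le
    have h₄ : 0 ≤ (j : ℝ) * h := by positivity
    exact ⟨by linarith, by linarith⟩
  have hsum : ∀ᶠ h : ℝ in nhdsWithin 0 (Set.Ioi 0), ∫ u in (0 : ℝ)..(x + 1), G h ⌊u / h⌋₊ =
      h ^ α * ∑ j ∈ Finset.range (⌊x / h⌋₊ + 1), c j * f (x - (j : ℝ) * h) := by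
    filter_upwards [self_mem_nhdsWithin, Ioo_mem_nhdsGT (zero_lt_one' ℝ)] with h hh hh1
    replace hh : 0 < h := hh
    obtain ⟨hI, hE⟩ := integral_comp_natFloor_div hh (G h) (⌊x / h⌋₊ + 1)
    have hle : ((⌊x / h⌋₊ + 1 : ℕ) : ℝ) * h ≤ x + 1 := by
      have := (natFloor_div_mul_mem_Ioc hx.le hh).2
      push_cast
      linarith [hh1.2]
    have hzero : Set.EqOn (fun _ => (0 : ℝ)) (fun u => G h ⌊u / h⌋₊)
        (Set.Ioo (((⌊x / h⌋₊ + 1 : ℕ) : ℝ) * h) (x + 1)) := by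
      intro u hu
      have : ⌊x / h⌋₊ + 1 ≤ ⌊u / h⌋₊ := Nat.le_floor ((le_div_iff₀ hh).2 hu.1.le)
      simp only [hG]
      rw [if_neg (by omega)]
    have hI' : IntervalIntegrable (fun u => G h ⌊u / h⌋₊) MeasureTheory.volume
        (((⌊x / h⌋₊ + 1 : ℕ) : ℝ) * h) (x + 1) := by
      refine (intervalIntegrable_const (c := (0 : ℝ))).congr_uIoo ?_
      rw [Set.uIoo_of_le hle]
      exact hzero
    rw [← integral_add_adjacent_intervals hI hI', hE,
      ← integral_congr_Ioo_of_le hle hzero, integral_zero, add_zero, Finset.mul_sum]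
    refine Finset.sum_congr rfl fun j hj => ?_
    have hj' : j ≤ ⌊x / h⌋₊ := Nat.lt_succ_iff.1 (Finset.mem_range.1 hj)
    have hpow : h * h ^ (α - 1) = h ^ α := by
      nth_rewrite 1 [← Real.rpow_one h]
      rw [← Real.rpow_add hh, add_sub_cancel]
    simp only [hG, if_pos hj']
    linear_combination c j * f (x - j * h) * hpow
  refine Tendsto.congr' hsum ?_
  have hlim : (1 / Real.Gamma α) * ∫ t in (0 : ℝ)..x, (x - t) ^ (α - 1) * f t =
      ∫ u in (0 : ℝ)..(x + 1),
        if u ≤ x then (Real.Gamma α)⁻¹ * u ^ (α - 1) * f (x - u) else 0 := by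
    have hsub := integral_comp_sub_left (a := 0) (b := x)
      (fun t => (x - t) ^ (α - 1) * f t) x
    simp only [sub_sub_cancel, sub_self, sub_zero] at hsub
    rw [← hsub, ← integral_const_mul, integral_of_le hx.le, integral_of_le (by linarith),
      ← MeasureTheory.integral_indicator measurableSet_Ioc,
      ← MeasureTheory.integral_indicator measurableSet_Ioc]
    congr 1
    ext u
    simp only [Set.indicator_apply, Set.mem_Ioc]
    by_cases h0 : 0 < u <;> by_cases h1 : u ≤ x <;> simp [h0, h1, mul_assoc]
    intro h2
    linarith
  rw [hlim]
  refine tendsto_integral_filter_of_dominated_convergence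
    (fun u => C * (u ^ (α - 1) + (x + 2) ^ (α - 1)) * M) ?_ ?_ ?_ ?_
  · refine Eventually.of_forall fun h => Measurable.aestronglyMeasurable ?_
    exact (measurable_from_nat (f := G h)).comp
      (Nat.measurable_floor.comp (measurable_id.div_const h))
  · filter_upwards [self_mem_nhdsWithin, Ioo_mem_nhdsGT (zero_lt_one' ℝ)] with h hh hh1
    replace hh : 0 < h := hh
    refine Eventually.of_forall fun u hu => ?_
    rw [Set.uIoc_of_le (by linarith)] at hu
    have hu0 : 0 ≤ u ^ (α - 1) := Real.rpow_nonneg hu.1.le _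
    have hx0 : 0 ≤ (x + 2) ^ (α - 1) := Real.rpow_nonneg (by linarith) _
    simp only [hG]
    split_ifs with hj
    · have hm := natFloor_div_mul_mem_Ioc hu.1.le hh
      have hv : u ≤ (⌊u / h⌋₊ : ℝ) * h + h := by linarith [hm.1]
      have hv' : (⌊u / h⌋₊ : ℝ) * h + h ≤ x + 2 := by linarith [hm.2, hu.2, hh1.2]
      have hvpos := hu.1.trans_le hv
      have hb : ((⌊u / h⌋₊ : ℝ) * h + h) ^ (α - 1) ≤ u ^ (α - 1) + (x + 2) ^ (α - 1) := by
        rcases le_total α 1 with h1 | h1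
        · linarith [Real.rpow_le_rpow_of_nonpos hu.1 hv (sub_nonpos.2 h1)]
        · linarith [Real.rpow_le_rpow hvpos.le hv' (sub_nonneg.2 h1)]
      rw [hcell h _ hh, norm_mul, norm_mul,
        Real.norm_of_nonneg (Real.rpow_nonneg hvpos.le (α - 1))]
      have h₁ := hM _ (hmem h _ hh hj)
      have h₂ := hC' ⌊u / h⌋₊
      rw [← Real.norm_eq_abs] at h₂
      have h₃ := Real.rpow_nonneg hvpos.le (α - 1)
      gcongr
    · rw [norm_zero]
      positivity
  · exact (((intervalIntegrable_rpow' (by linarith)).add intervalIntegrable_const).const_mul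
      C).mul_const M
  · have hne : ∀ᵐ u : ℝ, u ≠ x := by
      simp [MeasureTheory.ae_iff]
    filter_upwards [hne] with u hux hu
    rw [Set.uIoc_of_le (by linarith)] at hu
    have hm := tendsto_natFloor_div_mul hu.1.le
    have hid : Tendsto (fun h : ℝ => h) (nhdsWithin 0 (Set.Ioi 0)) (nhds 0) :=
      tendsto_id.mono_left nhdsWithin_le_nhds
    rcases lt_or_gt_of_ne hux with hlt | hgt
    · rw [if_pos hlt.le]
      have hfl : ∀ h : ℝ, 0 < h → ⌊u / h⌋₊ ≤ ⌊x / h⌋₊ := fun h hh =>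
        Nat.floor_mono (div_le_div_of_nonneg_right hlt.le hh.le)
      have hdiv : Tendsto (fun h : ℝ => ⌊u / h⌋₊) (nhdsWithin 0 (Set.Ioi 0)) atTop := by
        refine tendsto_nat_floor_atTop.comp ?_
        exact (tendsto_inv_nhdsGT_zero.const_mul_atTop hu.1).congr fun h =>
          (div_eq_mul_inv u h).symm
      have h₁ := ha.comp hdiv
      have h₂ : Tendsto (fun h : ℝ => ((⌊u / h⌋₊ : ℝ) * h + h) ^ (α - 1))
          (nhdsWithin 0 (Set.Ioi 0)) (nhds (u ^ (α - 1))) := by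
        have := hm.add hid
        rw [add_zero] at this
        exact this.rpow_const (Or.inl hu.1.ne')
      have h₃ : Tendsto (fun h : ℝ => f (x - ⌊u / h⌋₊ * h))
          (nhdsWithin 0 (Set.Ioi 0)) (nhds (f (x - u))) := by
        refine (hf (x - u) ⟨by linarith, by linarith [hu.1]⟩).tendsto.comp ?_
        refine tendsto_nhdsWithin_iff.2 ⟨hm.const_sub x, ?_⟩
        filter_upwards [self_mem_nhdsWithin] with h hh
        exact hmem h _ hh (hfl h hh)
      refine ((h₁.mul h₂).mul h₃).congr' ?_
      filter_upwards [self_mem_nhdsWithin] with h hh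
      simp only [hG]
      rw [if_pos (hfl h hh), hcell h _ hh]
      rfl
    · rw [if_neg (not_le.2 hgt)]
      refine tendsto_const_nhds.congr' ?_
      filter_upwards [self_mem_nhdsWithin, Ioo_mem_nhdsGT (sub_pos.2 hgt)] with h hh hh1
      have h₃ : ¬ ⌊u / h⌋₊ ≤ ⌊x / h⌋₊ := by
        intro hle
        have hlt : x / h + 1 ≤ u / h := by
          rw [← sub_nonneg]
          have : u / h - (x / h + 1) = (u - x - h) / h := by
            have : h ≠ 0 := (Set.mem_Ioi.1 hh).ne'
            field_simp
            ring
          rw [this]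
          exact div_nonneg (by linarith [hh1.2]) (Set.mem_Ioi.1 hh).le
        have := Nat.floor_mono hlt
        rw [Nat.floor_add_one (div_nonneg hx.le (Set.mem_Ioi.1 hh).le)] at this
        omega
      simp only [hG]
      rw [if_neg h₃]
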